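/- The (unnormalized) oriented volume operator A = −i[ J⃗₁·J⃗₂ , J⃗₁·J⃗₃ ] on (ℂ²)^⊗4 is Hermitian, and the states |V₊⟩ and |V₋⟩ are eigenvectors of A with opposite nonzero real eigenvalues: there exists a real number v ≠ 0 with A|V₊⟩ = v|V₊⟩ and A|V₋⟩ = −v|V₋⟩. -/

import Mathlib

open Matrix BigOperators

noncomputable section

/-- The four 2×2 Pauli matrices: σ₀ = I, σ₁ = X, σ₂ = Y, σ₃ = Z. -/
def pauli : Fin 4 → Matrix (Fin 2) (Fin 2) ℂ
  | 0 => 1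
  | 1 => !![0, 1; 1, 0]
  | 2 => !![0, -Complex.I; Complex.I, 0]
  | 3 => !![1, 0; 0, -1]

/-- Pauli string `σ_{f(1)} ⊗ ⋯ ⊗ σ_{f(n)}` on `n` qubits, as a matrix on
`(ℂ²)^⊗n`, realized as functions `(Fin n → Fin 2) → ℂ`. -/
def pauliString {n : ℕ} (f : Fin n → Fin 4) :
    Matrix (Fin n → Fin 2) (Fin n → Fin 2) ℂ :=
  Matrix.of fun r c => ∏ k, pauli (f k) (r k) (c k)

/-- Computational basis vector `|b₁…b_n⟩`. -/
def ket {n : ℕ} (b : Fin n → Fin 2) : (Fin n → Fin 2) → ℂ :=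
  fun i => if i = b then 1 else 0

/-- Logical intertwiner basis vector
`|0_s⟩ = ½(|0101⟩+|1010⟩−|0110⟩−|1001⟩)`. -/
def zeroS : (Fin 4 → Fin 2) → ℂ :=
  (2 : ℂ)⁻¹ • (ket ![0,1,0,1] + ket ![1,0,1,0] - ket ![0,1,1,0] - ket ![1,0,0,1])

/-- Logical intertwiner basis vector
`|1_s⟩ = (1/√3)[|0011⟩+|1100⟩ − ½(|0101⟩+|1010⟩+|0110⟩+|1001⟩)]`. -/
def oneS : (Fin 4 → Fin 2) → ℂ :=
  ((Real.sqrt 3 : ℂ))⁻¹ • (ket ![0,0,1,1] + ket ![1,1,0,0]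
    - (2 : ℂ)⁻¹ • (ket ![0,1,0,1] + ket ![1,0,1,0] + ket ![0,1,1,0] + ket ![1,0,0,1]))

/-- Volume eigenstate `|V₊⟩ = (1/√2)(|0_s⟩ − i|1_s⟩)`. -/
def Vplus : (Fin 4 → Fin 2) → ℂ :=
  ((Real.sqrt 2 : ℂ))⁻¹ • (zeroS - Complex.I • oneS)

/-- Volume eigenstate `|V₋⟩ = (1/√2)(|0_s⟩ + i|1_s⟩)`. -/
def Vminus : (Fin 4 → Fin 2) → ℂ :=
  ((Real.sqrt 2 : ℂ))⁻¹ • (zeroS + Complex.I • oneS)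

/-- `σ_a` acting on the `i`-th tensor factor of `(ℂ²)^⊗4`. -/
def pauliAt (i : Fin 4) (a : Fin 4) : Matrix (Fin 4 → Fin 2) (Fin 4 → Fin 2) ℂ :=
  pauliString (fun k => if k = i then a else 0)

/-- The spin-spin coupling `J⃗ᵢ·J⃗ⱼ = ¼ Σ_{a=1}^{3} σ_a^{(i)} σ_a^{(j)}`. -/
def Jdot (i j : Fin 4) : Matrix (Fin 4 → Fin 2) (Fin 4 → Fin 2) ℂ :=
  (4 : ℂ)⁻¹ • ∑ a : Fin 3, pauliAt i a.succ * pauliAt j a.succ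

/-- The (unnormalized) oriented volume operator `A = −i[J⃗₁·J⃗₂, J⃗₁·J⃗₃]`. -/
def volOp : Matrix (Fin 4 → Fin 2) (Fin 4 → Fin 2) ℂ :=
  (-Complex.I) • (Jdot 0 1 * Jdot 0 2 - Jdot 0 2 * Jdot 0 1)

/-- The entry of a one-site Pauli operator vanishes unless row and column agree off the site. -/
theorem pauliAt_apply (i a : Fin 4) (r c : Fin 4 → Fin 2) :
    pauliAt i a r c = if ∀ k, k ≠ i → r k = c k then pauli a (r i) (c i) else 0 := by
  have hone : ∀ x y : Fin 2, pauli 0 x y = if x = y then 1 else 0 := fun x y => by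
    simp [pauli, Matrix.one_apply]
  simp only [pauliAt, pauliString, Matrix.of_apply]
  rw [← Finset.mul_prod_erase _ _ (Finset.mem_univ i)]
  rw [Finset.prod_congr rfl (g := fun k => if r k = c k then (1 : ℂ) else 0) fun k hk => by
    rw [if_neg (Finset.ne_of_mem_erase hk), hone]]
  rw [Finset.prod_ite_zero]
  simp

theorem pauliAt_mulVec (i a : Fin 4) (ψ : (Fin 4 → Fin 2) → ℂ) (r : Fin 4 → Fin 2) :
    (pauliAt i a).mulVec ψ r = ∑ x, pauli a (r i) x * ψ (Function.update r i x) := by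
  rw [Matrix.mulVec, dotProduct, eq_comm]
  refine Finset.sum_of_injOn (Function.update r i) (Function.update_injective r i).injOn
    ?_ (fun c _ hc => ?_) (fun x _ => ?_)
  · simp [Set.MapsTo]
  · rw [pauliAt_apply, if_neg, zero_mul]
    intro h
    refine hc ⟨c i, by simp, ?_⟩
    ext1 k
    by_cases hk : k = i
    · subst hk; simp
    · simp [hk, h k hk]
  · rw [pauliAt_apply, if_pos]
    · simp
    · intro k hk
      simp [hk]

/-- The Pauli exchange identity `σ⃗ ⬝ σ⃗ = 2 SWAP - 1`, applied to a vector. -/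
theorem Jdot_mulVec {i j : Fin 4} (hij : i ≠ j) (ψ : (Fin 4 → Fin 2) → ℂ)
    (r : Fin 4 → Fin 2) :
    (Jdot i j).mulVec ψ r = 2⁻¹ * ψ (r ∘ Equiv.swap i j) - 4⁻¹ * ψ r := by
  have hswap : r ∘ Equiv.swap i j = Function.update (Function.update r i (r j)) j (r i) := by
    ext1 k
    by_cases hj : k = j
    · subst hj; simp
    · by_cases hi : k = i
      · subst hi; simp [hj]
      · simp [hi, hj, Equiv.swap_apply_of_ne_of_ne hi hj]
  have hself : ψ r = ψ (Function.update (Function.update r i (r i)) j (r j)) := by simp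
  rw [hswap, hself]
  simp only [Jdot, Matrix.smul_mulVec, Matrix.sum_mulVec, ← Matrix.mulVec_mulVec, Pi.smul_apply,
    Finset.sum_apply, pauliAt_mulVec, smul_eq_mul, Function.update_of_ne hij.symm]
  generalize r i = x
  generalize r j = y
  fin_cases x <;> fin_cases y <;> simp [Fin.sum_univ_succ, pauli] <;> grind [Complex.I_mul_I]

theorem Jdot_mulVec_ket {i j : Fin 4} (hij : i ≠ j) (b : Fin 4 → Fin 2) :
    (Jdot i j).mulVec (ket b) =
      (2 : ℂ)⁻¹ • ket (b ∘ Equiv.swap i j) - (4 : ℂ)⁻¹ • ket b := by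
  ext r
  have h : r ∘ Equiv.swap i j = b ↔ r = b ∘ Equiv.swap i j := by
    constructor <;> rintro rfl <;> ext k <;> simp
  simp [Jdot_mulVec hij, ket, h]

theorem Jdot_isHermitian {i j : Fin 4} (hij : i ≠ j) : (Jdot i j).IsHermitian := by
  have hentry : ∀ r c, Jdot i j r c = 2⁻¹ * ket c (r ∘ Equiv.swap i j) - 4⁻¹ * ket c r := by
    intro r c
    rw [← Jdot_mulVec hij]
    simp [Matrix.mulVec, dotProduct, ket]
  ext r c
  have h : c ∘ Equiv.swap i j = r ↔ r ∘ Equiv.swap i j = c := by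
    constructor <;> rintro rfl <;> ext k <;> simp
  simp only [Matrix.conjTranspose_apply, hentry, ket, h, eq_comm (a := c) (b := r)]
  split_ifs <;> simp

theorem volOp_isHermitian : volOp.IsHermitian := by
  have h₁ := (Jdot_isHermitian (i := 0) (j := 1) (by decide)).eq
  have h₂ := (Jdot_isHermitian (i := 0) (j := 2) (by decide)).eq
  simp only [Matrix.IsHermitian, volOp, Matrix.conjTranspose_smul, Matrix.conjTranspose_sub,
    Matrix.conjTranspose_mul, h₁, h₂]
  simp [smul_sub]
  abel

/-- The volume operator is a difference of the two cyclic permutations of the first three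
qubits. -/
theorem volOp_mulVec_ket (w x y z : Fin 2) :
    volOp.mulVec (ket ![w, x, y, z]) =
      (-Complex.I / 4) • (ket ![x, y, w, z] - ket ![y, w, x, z]) := by
  have h₁ : ∀ w x y z : Fin 2, ![w, x, y, z] ∘ Equiv.swap (0 : Fin 4) 1 = ![x, w, y, z] := by
    decide
  have h₂ : ∀ w x y z : Fin 2, ![w, x, y, z] ∘ Equiv.swap (0 : Fin 4) 2 = ![y, x, w, z] := by
    decide
  simp only [volOp, Matrix.smul_mulVec, Matrix.sub_mulVec, ← Matrix.mulVec_mulVec,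
    Jdot_mulVec_ket (show (0 : Fin 4) ≠ 1 by decide),
    Jdot_mulVec_ket (show (0 : Fin 4) ≠ 2 by decide), Matrix.mulVec_sub, Matrix.mulVec_smul, h₁, h₂]
  module

theorem sqrt_three_mul_self : (Real.sqrt 3 : ℂ) * Real.sqrt 3 = 3 := by
  rw [← Complex.ofReal_mul, Real.mul_self_sqrt (by norm_num)]
  norm_num

theorem volOp_mulVec_zeroS :
    volOp.mulVec zeroS = (Complex.I * Real.sqrt 3 / 4) • oneS := by
  have h : (Real.sqrt 3 : ℂ) ≠ 0 := by simp
  simp only [zeroS, oneS, Matrix.mulVec_smul, Matrix.mulVec_add, Matrix.mulVec_sub,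
    volOp_mulVec_ket]
  match_scalars <;> field_simp <;> norm_num

theorem volOp_mulVec_oneS :
    volOp.mulVec oneS = (-Complex.I * Real.sqrt 3 / 4) • zeroS := by
  have h : (Real.sqrt 3 : ℂ)⁻¹ = Real.sqrt 3 / 3 := by
    rw [← sqrt_three_mul_self]
    field_simp
  simp only [zeroS, oneS, Matrix.mulVec_smul, Matrix.mulVec_add, Matrix.mulVec_sub,
    volOp_mulVec_ket, h]
  module

/-- the oriented volume operator is Hermitian and |V₊⟩, |V₋⟩ are its
eigenvectors with opposite nonzero real eigenvalues. -/
theorem volOp_hermitian_and_eigenvectors :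
    volOp.IsHermitian ∧
    ∃ v : ℝ, v ≠ 0 ∧ volOp.mulVec Vplus = (v : ℂ) • Vplus ∧
      volOp.mulVec Vminus = (-v : ℂ) • Vminus := by
  refine ⟨volOp_isHermitian, -(Real.sqrt 3 / 4), by simp, ?_, ?_⟩
  · simp only [Vplus, Matrix.mulVec_smul, Matrix.mulVec_sub, volOp_mulVec_zeroS,
      volOp_mulVec_oneS]
    push_cast
    match_scalars <;> ring_nf
    simp
    ring
  · simp only [Vminus, Matrix.mulVec_smul, Matrix.mulVec_add, volOp_mulVec_zeroS,
      volOp_mulVec_oneS]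
    push_cast
    match_scalars <;> ring_nf
    simp
    ring
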